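/- arXiv:1901.08566 — 3 statements merged into one kernel-verified Lean document; each statement's English description precedes it below -/
import Mathlib

section
/- Let d, n be positive integers and M ∈ P(d,n). Then the robustness R_IC(M) with respect to the incoherent measurements equals the supremum, over all tuples (Z_1, …, Z_n) of positive semidefinite d×d complex matrices satisfying ⟨i|Z_a|i⟩ = ⟨i|Z_n|i⟩ for every a ∈ {1,…,n} and every standard basis index i ∈ {1,…,d}, and tr(Z_n) = 1, of the quantity Σ_{a=1}^n tr(Z_a M_a) − 1. -/
open scoped BigOperators ComplexOrder

/-- An `n`-outcome POVM on `ℂ^d`: a tuple of positive semidefinite matrices summing to `1`. -/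
def IsPOVM {d n : ℕ} (M : Fin n → Matrix (Fin d) (Fin d) ℂ) : Prop :=
  (∀ i, (M i).PosSemidef) ∧ ∑ i, M i = 1

/-- The set of incoherent `n`-outcome POVMs on `ℂ^d`: all effects are diagonal
in the standard basis. -/
def IC (d n : ℕ) : Set (Fin n → Matrix (Fin d) (Fin d) ℂ) :=
  {S | IsPOVM S ∧ ∀ a, ∀ i j, i ≠ j → S a i j = 0}

/-- The set of admissible noise parameters `s ≥ 0` for which some POVM `N` makes
`(M + s N)/(1+s)` a member of `F`. -/
def robustnessSet {d n : ℕ} (F : Set (Fin n → Matrix (Fin d) (Fin d) ℂ))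
    (M : Fin n → Matrix (Fin d) (Fin d) ℂ) : Set ℝ :=
  {s : ℝ | 0 ≤ s ∧ ∃ N, IsPOVM N ∧
    (fun i => (1 + s)⁻¹ • (M i + s • N i)) ∈ F}

/-- The robustness of `M` with respect to `F`. -/
noncomputable def robustness {d n : ℕ} (F : Set (Fin n → Matrix (Fin d) (Fin d) ℂ))
    (M : Fin n → Matrix (Fin d) (Fin d) ℂ) : ℝ :=
  sInf (robustnessSet F M)

open Matrix

/-- The trace pairing of two positive semidefinite matrices is nonnegative. -/
lemma posSemidef_trace_mul_nonneg {d : ℕ} {A B : Matrix (Fin d) (Fin d) ℂ}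
    (hA : A.PosSemidef) (hB : B.PosSemidef) : 0 ≤ ((A * B).trace).re := by
  open scoped MatrixOrder in
  obtain ⟨C, rfl⟩ := CStarAlgebra.nonneg_iff_eq_star_mul_self.mp hB.nonneg
  rw [← Matrix.mul_assoc, Matrix.trace_mul_comm, ← Matrix.mul_assoc]
  exact (Complex.nonneg_iff.mp (hA.mul_mul_conjTranspose_same C).trace_nonneg).1

/-- The trace against a positive semidefinite matrix is monotone in the Loewner order. -/
lemma re_trace_mul_le {d : ℕ} {A B C : Matrix (Fin d) (Fin d) ℂ}
    (hA : A.PosSemidef) (h : (C - B).PosSemidef) :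
    ((A * B).trace).re ≤ ((A * C).trace).re := by
  have := posSemidef_trace_mul_nonneg hA h
  rw [Matrix.mul_sub, Matrix.trace_sub, Complex.sub_re] at this
  linarith

/-- A real-linear functional on complex matrices is the real part of a trace pairing. -/
lemma exists_re_trace_mul_eq {d : ℕ} (g : Matrix (Fin d) (Fin d) ℂ →ₗ[ℝ] ℝ) :
    ∃ G : Matrix (Fin d) (Fin d) ℂ, ∀ X, ((G * X).trace).re = g X := by
  refine ⟨Matrix.of fun j i =>
    ⟨g (Matrix.single i j 1), -g (Matrix.single i j Complex.I)⟩, fun X => ?_⟩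
  have hs : ∀ i j, g (Matrix.single i j (X i j)) =
      (X i j).re * g (Matrix.single i j 1) + (X i j).im * g (Matrix.single i j Complex.I) := by
    intro i j
    rw [← smul_eq_mul, ← smul_eq_mul, ← map_smul, ← map_smul, ← map_add, Matrix.smul_single,
      Matrix.smul_single, ← Matrix.single_add]
    congr 2
    simp [Complex.re_add_im]
  conv_rhs => rw [Matrix.matrix_eq_sum_single X]
  simp only [map_sum, hs, Matrix.trace, Matrix.diag_apply, Matrix.mul_apply, Matrix.of_apply,
    Complex.re_sum, Complex.mul_re]
  rw [Finset.sum_comm]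
  refine Finset.sum_congr rfl fun i _ => Finset.sum_congr rfl fun j _ => ?_
  ring

/-- A real-linear functional that is nonnegative on positive semidefinite matrices is represented
on Hermitian matrices by a positive semidefinite matrix. -/
lemma exists_posSemidef_re_trace_mul_eq {d : ℕ} (g : Matrix (Fin d) (Fin d) ℂ →ₗ[ℝ] ℝ)
    (hg : ∀ X : Matrix (Fin d) (Fin d) ℂ, X.PosSemidef → 0 ≤ g X) :
    ∃ Z : Matrix (Fin d) (Fin d) ℂ, Z.PosSemidef ∧
      ∀ X : Matrix (Fin d) (Fin d) ℂ, X.IsHermitian → ((Z * X).trace).re = g X := by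
  obtain ⟨G, hG⟩ := exists_re_trace_mul_eq g
  set Z : Matrix (Fin d) (Fin d) ℂ := (2⁻¹ : ℝ) • (G + Gᴴ) with hZ
  have hH : Z.IsHermitian := by
    rw [Matrix.IsHermitian, hZ, Matrix.conjTranspose_smul, Matrix.conjTranspose_add,
      Matrix.conjTranspose_conjTranspose, add_comm, star_trivial]
  have hrep : ∀ X : Matrix (Fin d) (Fin d) ℂ, X.IsHermitian → ((Z * X).trace).re = g X := by
    intro X hX
    have h1 : ((Gᴴ * X).trace).re = g X := by
      have hX' : Gᴴ * X = (X * G)ᴴ := by rw [Matrix.conjTranspose_mul, hX.eq]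
      rw [← hG X, Matrix.trace_mul_comm G, hX', Matrix.trace_conjTranspose]
      simp
    rw [hZ, Matrix.smul_mul, Matrix.trace_smul, Complex.smul_re, Matrix.add_mul, Matrix.trace_add,
      Complex.add_re, h1, hG, smul_eq_mul]
    ring
  refine ⟨Z, .of_dotProduct_mulVec_nonneg hH fun x => ?_, hrep⟩
  have hx := Matrix.posSemidef_vecMulVec_self_star x
  have hre := hg _ hx
  rw [← hrep _ hx.isHermitian, Matrix.mul_vecMulVec, Matrix.trace_vecMulVec, dotProduct_comm] at hre
  exact Complex.nonneg_iff.mpr ⟨hre, (hH.im_star_dotProduct_mulVec_self x).symm⟩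

lemma isClosed_setOf_posSemidef (d : ℕ) :
    IsClosed {A : Matrix (Fin d) (Fin d) ℂ | A.PosSemidef} := by
  simp only [Matrix.posSemidef_iff_dotProduct_mulVec, Set.ofPred_and, Set.ofPred_forall]
  refine IsClosed.inter (isClosed_eq (by fun_prop) (by fun_prop)) (isClosed_iInter fun x => ?_)
  exact isClosed_le continuous_const (by fun_prop)

/-- The trace pairing with a real diagonal matrix. -/
lemma re_trace_mul_diagonal {d : ℕ} (Z : Matrix (Fin d) (Fin d) ℂ) (q : Fin d → ℝ) :
    ((Z * Matrix.diagonal fun j => (q j : ℂ)).trace).re = ∑ j, (Z j j).re * q j := by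
  simp [Matrix.trace, Matrix.mul_diagonal]

lemma mem_robustnessSet_of_diagonal {d n : ℕ} {M : Fin n → Matrix (Fin d) (Fin d) ℂ}
    (hM : IsPOVM M) {s : ℝ} (hs : 0 ≤ s) (q : Fin n → Fin d → ℝ)
    (hq0 : ∀ a j, 0 ≤ q a j) (hq : ∀ j, ∑ a, q a j = 1 + s)
    (h : ∀ a, (Matrix.diagonal (fun j => (q a j : ℂ)) - M a).PosSemidef) :
    s ∈ robustnessSet (IC d n) M := by
  have hsum : ∑ a, Matrix.diagonal (fun j => (q a j : ℂ)) =
      (1 + s) • (1 : Matrix (Fin d) (Fin d) ℂ) := by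
    ext i j
    rw [Matrix.sum_apply]
    by_cases hij : i = j
    · subst hij
      simp [← Complex.ofReal_sum, hq]
    · simp [hij]
  have hdiff : ∑ a, (Matrix.diagonal (fun j => (q a j : ℂ)) - M a) =
      s • (1 : Matrix (Fin d) (Fin d) ℂ) := by
    rw [Finset.sum_sub_distrib, hsum, hM.2, add_smul, one_smul, add_sub_cancel_left]
  have hN : ∃ N, IsPOVM N ∧ ∀ a, M a + s • N a = Matrix.diagonal fun j => (q a j : ℂ) := by
    rcases hs.eq_or_lt with rfl | hpos
    · refine ⟨M, hM, fun a => ?_⟩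
      have ht : ∑ a, (Matrix.diagonal (fun j => (q a j : ℂ)) - M a).trace = 0 := by
        rw [← Matrix.trace_sum, hdiff, zero_smul, Matrix.trace_zero]
      have := (Finset.sum_eq_zero_iff_of_nonneg fun a _ => (h a).trace_nonneg).mp ht a
        (Finset.mem_univ a)
      rw [(h a).trace_eq_zero_iff, sub_eq_zero] at this
      rw [zero_smul, add_zero, this]
    · refine ⟨fun a => s⁻¹ • (Matrix.diagonal (fun j => (q a j : ℂ)) - M a),
        ⟨fun a => (h a).smul (inv_nonneg.mpr hs), ?_⟩, fun a => ?_⟩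
      · rw [← Finset.smul_sum, hdiff, inv_smul_smul₀ hpos.ne']
      · rw [smul_inv_smul₀ hpos.ne', add_sub_cancel]
  obtain ⟨N, hNP, hMN⟩ := hN
  have h1s : 0 < 1 + s := by linarith
  refine ⟨hs, N, hNP, ?_⟩
  simp only [hMN]
  refine ⟨⟨fun a => ?_, ?_⟩, fun a i j hij => by simp [hij]⟩
  · refine Matrix.PosSemidef.smul (.diagonal fun j => ?_) (inv_nonneg.mpr h1s.le)
    exact Complex.zero_le_real.mpr (hq0 a j)
  · rw [← Finset.smul_sum, hsum, inv_smul_smul₀ h1s.ne']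

/-- Weak duality. -/
lemma sum_re_trace_mul_le_of_mem_robustnessSet {d n : ℕ}
    {M : Fin n → Matrix (Fin d) (Fin d) ℂ} {s : ℝ} (h : s ∈ robustnessSet (IC d n) M)
    {Z : Fin n → Matrix (Fin d) (Fin d) ℂ} (hZ : ∀ a, (Z a).PosSemidef)
    {Y : Matrix (Fin d) (Fin d) ℂ} (hdiag : ∀ a i, Z a i i = Y i i) (htr : Y.trace = 1) :
    ∑ a, ((Z a * M a).trace).re ≤ 1 + s := by
  obtain ⟨hs, N, hN, ⟨-, hS1⟩, hSd⟩ := h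
  set S := fun a => (1 + s)⁻¹ • (M a + s • N a) with hS
  have h1s : 0 < 1 + s := by linarith
  have hMS : ∀ a, (1 + s) • S a = M a + s • N a := fun a => smul_inv_smul₀ h1s.ne' _
  have hle : ∀ a, ((Z a * M a).trace).re ≤ (1 + s) * ((Z a * S a).trace).re := by
    intro a
    have := re_trace_mul_le (hZ a) (B := M a) (C := (1 + s) • S a)
      (by rw [hMS, add_sub_cancel_left]; exact (hN.1 a).smul hs)
    rwa [Matrix.mul_smul, Matrix.trace_smul, Complex.smul_re, smul_eq_mul] at this
  have hone : ∑ a, (Z a * S a).trace = 1 := by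
    have : ∀ a, (Z a * S a).trace = ∑ i, Y i i * S a i i := by
      intro a
      simp only [Matrix.trace, Matrix.diag_apply, Matrix.mul_apply]
      refine Finset.sum_congr rfl fun i _ => ?_
      rw [Finset.sum_eq_single i (fun j _ hj => by rw [hSd a j i hj, mul_zero]) (by simp), hdiag]
    simp only [this]
    rw [Finset.sum_comm]
    simp only [← Finset.mul_sum, ← Matrix.sum_apply]
    rw [hS1]
    simpa [Matrix.trace] using htr
  calc ∑ a, ((Z a * M a).trace).re ≤ ∑ a, (1 + s) * ((Z a * S a).trace).re :=
        Finset.sum_le_sum fun a _ => hle a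
    _ = 1 + s := by rw [← Finset.mul_sum, ← Complex.re_sum, hone, Complex.one_re, mul_one]

/-- If no diagonal tuple with column sums `t` dominates `M`, then some tuple of positive
semidefinite matrices separates `M` from all of these tuples. -/
lemma exists_posSemidef_separating {d n : ℕ} {M : Fin n → Matrix (Fin d) (Fin d) ℂ}
    (hM : ∀ a, (M a).PosSemidef) (t : ℝ)
    (h : ¬ ∃ p : Fin d → Fin n → ℝ, (∀ j, p j ∈ stdSimplex ℝ (Fin n)) ∧
      ∀ a, (Matrix.diagonal (fun j => ((t * p j a : ℝ) : ℂ)) - M a).PosSemidef) :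
    ∃ Z : Fin n → Matrix (Fin d) (Fin d) ℂ, (∀ a, (Z a).PosSemidef) ∧
      ∀ p : Fin d → Fin n → ℝ, (∀ j, p j ∈ stdSimplex ℝ (Fin n)) →
        ∑ a, ∑ j, (Z a j j).re * (t * p j a) < ∑ a, ((Z a * M a).trace).re := by
  have : LocallyConvexSpace ℝ (Matrix (Fin d) (Fin d) ℂ) :=
    inferInstanceAs (LocallyConvexSpace ℝ (Fin d → Fin d → ℂ))
  let L : (Fin d → Fin n → ℝ) →ₗ[ℝ] (Fin n → Matrix (Fin d) (Fin d) ℂ) :=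
    { toFun := fun p a => Matrix.diagonal fun j => ((t * p j a : ℝ) : ℂ)
      map_add' := fun p q => by
        ext a i j
        by_cases hij : i = j
        · subst hij
          simp [mul_add]
        · simp [hij]
      map_smul' := fun c p => by
        ext a i j
        by_cases hij : i = j
        · subst hij
          simp
          ring
        · simp [hij] }
  have hLc : Continuous L := continuous_pi fun a =>
    Continuous.matrix_diagonal (continuous_pi fun j => by fun_prop)
  let S : Set (Fin d → Fin n → ℝ) := Set.univ.pi fun _ => stdSimplex ℝ (Fin n)
  have hSc : IsCompact S := isCompact_univ_pi fun _ => isCompact_stdSimplex ℝ (Fin n)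
  have hSv : Convex ℝ S := convex_pi fun _ _ => convex_stdSimplex ℝ (Fin n)
  let C : Set (Fin n → Matrix (Fin d) (Fin d) ℂ) := {X | ∀ a, (X a - M a).PosSemidef}
  have hCc : IsClosed C := by
    simp only [C, Set.ofPred_forall]
    refine isClosed_iInter fun a => ?_
    have hcont : Continuous fun X : Fin n → Matrix (Fin d) (Fin d) ℂ => X a - M a :=
      (continuous_apply a).sub continuous_const
    exact (isClosed_setOf_posSemidef d).preimage hcont
  have hCv : Convex ℝ C := by
    intro X hX Y hY x y hx hy hxy a
    have := ((hX a).smul hx).add ((hY a).smul hy)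
    convert this using 1
    have hm : M a = (x + y) • M a := by rw [hxy, one_smul]
    conv_lhs => rw [hm]
    simp only [Pi.add_apply, Pi.smul_apply, smul_sub, add_smul]
    abel
  have hdisj : Disjoint (L '' S) C := by
    rw [Set.disjoint_left]
    rintro _ ⟨p, hp, rfl⟩ hC
    exact h ⟨p, fun j => hp j trivial, hC⟩
  obtain ⟨f, u, v, hfu, huv, hfv⟩ := geometric_hahn_banach_compact_closed
    (hSv.linear_image L) (hSc.image hLc) hCv hCc hdisj
  have hfM : v < f M := hfv M fun a => by rw [sub_self]; exact .zero
  have hpos : ∀ P : Fin n → Matrix (Fin d) (Fin d) ℂ, (∀ a, (P a).PosSemidef) → 0 ≤ f P := by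
    intro P hP
    by_contra! hneg
    have hc : 0 ≤ (v - f M) / f P := div_nonneg_of_nonpos (by linarith) hneg.le
    have := hfv (M + ((v - f M) / f P) • P) fun a => by
      simpa using (hP a).smul hc
    rw [map_add, map_smul, smul_eq_mul, div_mul_cancel₀ _ hneg.ne] at this
    linarith
  have hrep : ∀ a, ∃ Z : Matrix (Fin d) (Fin d) ℂ, Z.PosSemidef ∧
      ∀ X : Matrix (Fin d) (Fin d) ℂ, X.IsHermitian →
        ((Z * X).trace).re = f (Pi.single a X) := by
    intro a
    refine exists_posSemidef_re_trace_mul_eq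
      (f.toLinearMap ∘ₗ LinearMap.single ℝ (fun _ => Matrix (Fin d) (Fin d) ℂ) a)
      fun X hX => hpos _ fun b => ?_
    by_cases hb : b = a
    · subst hb
      simpa using hX
    · simpa [hb] using Matrix.PosSemidef.zero
  choose Z hZ hZf using hrep
  have hf : ∀ X : Fin n → Matrix (Fin d) (Fin d) ℂ, (∀ a, (X a).IsHermitian) →
      ∑ a, ((Z a * X a).trace).re = f X := by
    intro X hX
    rw [Finset.sum_congr rfl fun a _ => hZf a _ (hX a), ← map_sum, Finset.univ_sum_single]
  refine ⟨Z, hZ, fun p hp => ?_⟩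
  simp only [← re_trace_mul_diagonal]
  rw [hf M fun a => (hM a).isHermitian]
  have hL := hf (L p) fun a => Matrix.isHermitian_diagonal_of_self_adjoint _ <| by
    ext j
    simp
  calc _ = f (L p) := hL
    _ < u := hfu _ ⟨p, fun j _ => hp j, rfl⟩
    _ < f M := huv.trans hfM

/-- Strong duality: an infeasible noise level is exceeded by a feasible dual value. -/
lemma exists_dual_gt_of_notMem_robustnessSet {d n : ℕ} (hn : 0 < n)
    {M : Fin n → Matrix (Fin d) (Fin d) ℂ} (hM : IsPOVM M) {s : ℝ} (hs : 0 ≤ s)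
    (h : s ∉ robustnessSet (IC d n) M) :
    ∃ Z : Fin n → Matrix (Fin d) (Fin d) ℂ, (∀ a, (Z a).PosSemidef) ∧
      (∀ a b i, Z a i i = Z b i i) ∧ (∀ a, (Z a).trace = 1) ∧
      1 + s < ∑ a, ((Z a * M a).trace).re := by
  have : Nonempty (Fin n) := ⟨⟨0, hn⟩⟩
  have h1s : 0 < 1 + s := by linarith
  obtain ⟨Z, hZ, hlt⟩ := exists_posSemidef_separating hM.1 (1 + s) fun ⟨p, hp, hP⟩ =>
    h <| mem_robustnessSet_of_diagonal hM hs (fun a j => (1 + s) * p j a)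
      (fun a j => mul_nonneg h1s.le ((hp j).1 a))
      (fun j => by rw [← Finset.mul_sum, (hp j).2, mul_one]) hP
  choose m hm using fun j => Finite.exists_max fun a => (Z a j j).re
  set w : Fin d → ℝ := fun j => (Z (m j) j j).re with hw
  have hlt' := hlt (fun j => Pi.single (m j) 1) fun j => single_mem_stdSimplex ℝ (m j)
  have hval : ∑ a, ∑ j, (Z a j j).re * ((1 + s) * Pi.single (M := fun _ => ℝ) (m j) 1 a) =
      (1 + s) * ∑ j, w j := by
    rw [Finset.sum_comm, Finset.mul_sum]
    refine Finset.sum_congr rfl fun j _ => ?_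
    rw [Finset.sum_eq_single (m j) (fun a _ ha => by simp [ha]) (by simp)]
    simp [hw, mul_comm]
  rw [hval] at hlt'
  set Z' : Fin n → Matrix (Fin d) (Fin d) ℂ :=
    fun a => Z a + Matrix.diagonal fun j => ((w j - (Z a j j).re : ℝ) : ℂ) with hZ'
  have hgap : ∀ a, (Matrix.diagonal fun j => ((w j - (Z a j j).re : ℝ) : ℂ)).PosSemidef :=
    fun a => .diagonal fun j => Complex.zero_le_real.mpr (sub_nonneg.mpr (hm j a))
  have hZ'P : ∀ a, (Z' a).PosSemidef := fun a => (hZ a).add (hgap a)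
  have hZ'd : ∀ a j, Z' a j j = (w j : ℂ) := by
    intro a j
    have him := (Complex.nonneg_iff.mp ((hZ a).diag_nonneg (i := j))).2
    apply Complex.ext <;> simp [hZ', ← him]
  have hZ't : ∀ a, (Z' a).trace = ((∑ j, w j : ℝ) : ℂ) := by
    intro a
    simp [Matrix.trace, hZ'd]
  have hgt : (1 + s) * ∑ j, w j < ∑ a, ((Z' a * M a).trace).re := by
    refine hlt'.trans_le (Finset.sum_le_sum fun a _ => ?_)
    have := posSemidef_trace_mul_nonneg (hgap a) (hM.1 a)
    simp only [hZ', Matrix.add_mul, Matrix.trace_add, Complex.add_re]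
    linarith
  have hw0 : 0 ≤ ∑ j, w j := Finset.sum_nonneg fun j _ =>
    (Complex.nonneg_iff.mp ((hZ (m j)).diag_nonneg (i := j))).1
  have hwpos : 0 < ∑ j, w j := by
    refine hw0.lt_of_ne fun h0 => ?_
    have : ∀ a, Z' a = 0 := fun a => by
      rw [← (hZ'P a).trace_eq_zero_iff, hZ't, ← h0, Complex.ofReal_zero]
    simp [this, ← h0] at hgt
  refine ⟨fun a => (∑ j, w j)⁻¹ • Z' a, fun a => (hZ'P a).smul (inv_nonneg.mpr hw0),
    fun a b i => by simp only [Matrix.smul_apply, hZ'd], fun a => ?_, ?_⟩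
  · rw [Matrix.trace_smul, hZ't, Complex.real_smul, ← Complex.ofReal_mul,
      inv_mul_cancel₀ hwpos.ne', Complex.ofReal_one]
  · simp only [Matrix.smul_mul, Matrix.trace_smul, Complex.smul_re, smul_eq_mul]
    rw [← Finset.mul_sum, ← div_eq_inv_mul, lt_div_iff₀ hwpos]
    exact hgt

/-- Dual characterization of the robustness with respect to incoherent measurements. -/
theorem robustness_IC_dual {d n : ℕ} (hd : 0 < d) (hn : 0 < n)
    (M : Fin n → Matrix (Fin d) (Fin d) ℂ) (hM : IsPOVM M) :
    robustness (IC d n) M = sSup {x : ℝ |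
      ∃ Z : Fin n → Matrix (Fin d) (Fin d) ℂ,
        (∀ a, (Z a).PosSemidef) ∧
        (∀ a i, Z a i i = Z ⟨n - 1, by omega⟩ i i) ∧
        (Z ⟨n - 1, by omega⟩).trace = 1 ∧
        x = ∑ a, ((Z a * M a).trace).re - 1} := by
  set D : Set ℝ := {x : ℝ |
      ∃ Z : Fin n → Matrix (Fin d) (Fin d) ℂ,
        (∀ a, (Z a).PosSemidef) ∧
        (∀ a i, Z a i i = Z ⟨n - 1, by omega⟩ i i) ∧
        (Z ⟨n - 1, by omega⟩).trace = 1 ∧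
        x = ∑ a, ((Z a * M a).trace).re - 1} with hD
  have h0 : (0 : ℝ) ∈ D := by
    refine ⟨fun _ => Matrix.single ⟨0, hd⟩ ⟨0, hd⟩ 1, fun _ => ?_, fun _ _ => rfl, by simp, ?_⟩
    · rw [← Matrix.diagonal_single]
      exact .diagonal (Pi.single_nonneg.mpr zero_le_one)
    · rw [← Complex.re_sum, ← Matrix.trace_sum, ← Matrix.mul_sum, hM.2]
      simp
  have hbdd : BddAbove D := by
    refine ⟨n - 1, ?_⟩
    rintro _ ⟨Z, hZ, hdiag, htr, rfl⟩
    refine sub_le_sub_right ?_ 1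
    calc ∑ a, ((Z a * M a).trace).re ≤ ∑ _a : Fin n, (1 : ℝ) := by
          refine Finset.sum_le_sum fun a _ => ?_
          have hle := re_trace_mul_le (hZ a) (B := M a) (C := 1) <| by
            rw [← hM.2, ← Finset.sum_erase_eq_sub (Finset.mem_univ a)]
            exact Matrix.posSemidef_sum _ fun b _ => hM.1 b
          have hta : (Z a).trace = 1 := by
            rw [← htr]
            exact Finset.sum_congr rfl fun i _ => hdiag a i
          rwa [mul_one, hta, Complex.one_re] at hle
      _ = n := by simp
  have hsup : sSup D ∈ robustnessSet (IC d n) M := by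
    by_contra hnot
    obtain ⟨Z, hZ, hdiag, htr, hlt⟩ :=
      exists_dual_gt_of_notMem_robustnessSet hn hM (le_csSup hbdd h0) hnot
    have := le_csSup hbdd (show ∑ a, ((Z a * M a).trace).re - 1 ∈ D from
      ⟨Z, hZ, fun a i => hdiag a _ i, htr _, rfl⟩)
    linarith
  refine le_antisymm (csInf_le ⟨0, fun s hs => hs.1⟩ hsup) (le_csInf ⟨_, hsup⟩ fun s hs => ?_)
  refine csSup_le ⟨0, h0⟩ ?_
  rintro _ ⟨Z, hZ, hdiag, htr, rfl⟩
  linarith [sum_re_trace_mul_le_of_mem_robustnessSet hs hZ hdiag htr]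
end

section
/- Let n ≥ d ≥ 1 and let M̃ ∈ P(d,n) be the POVM whose effects are M̃_j = |j̃⟩⟨j̃| for 1 ≤ j ≤ d and M̃_j = 0 for d < j ≤ n, where |j̃⟩ = (1/√d) Σ_{k=0}^{d−1} e^{2πi jk/d} |k⟩ are the Fourier basis vectors of ℂ^d. Then R_IC(M̃) = d − 1. -/
open scoped BigOperators ComplexOrder

/-- The `j`-th Fourier basis vector `|j̃⟩ = (1/√d) Σ_k e^{2πi jk/d} |k⟩` of `ℂ^d`. -/
noncomputable def fourierVec (d : ℕ) (j : Fin d) : Fin d → ℂ :=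
  fun k => ((Real.sqrt d : ℝ) : ℂ)⁻¹ *
    Complex.exp (2 * Real.pi * Complex.I * (j.val : ℂ) * (k.val : ℂ) / (d : ℂ))

/-- The `n`-outcome POVM on `ℂ^d` whose first `d` effects are the rank-one projectors
onto the Fourier basis vectors and whose remaining effects vanish. -/
noncomputable def fourierPOVM (d n : ℕ) : Fin n → Matrix (Fin d) (Fin d) ℂ :=
  fun j =>
    if h : (j : ℕ) < d then
      Matrix.of (fun k l => fourierVec d ⟨j, h⟩ k * (starRingEnd ℂ) (fourierVec d ⟨j, h⟩ l))
    else 0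

theorem fourierVec_mul_conj {d : ℕ} (hd : 0 < d) (j k l : Fin d) :
    fourierVec d j k * (starRingEnd ℂ) (fourierVec d j l) =
      (d : ℂ)⁻¹ * (Complex.exp (2 * Real.pi * Complex.I / (d : ℂ)) ^ (k : ℕ) *
        (Complex.exp (2 * Real.pi * Complex.I / (d : ℂ)) ^ (l : ℕ))⁻¹) ^ (j : ℕ) := by
  have hd' : (d : ℂ) ≠ 0 := by exact_mod_cast hd.ne'
  have hs : ((Real.sqrt d : ℝ) : ℂ)⁻¹ * ((Real.sqrt d : ℝ) : ℂ)⁻¹ = (d : ℂ)⁻¹ := by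
    rw [← mul_inv, ← Complex.ofReal_mul, Real.mul_self_sqrt (Nat.cast_nonneg d),
      Complex.ofReal_natCast]
  simp only [fourierVec, map_mul, map_inv₀, Complex.conj_ofReal, ← Complex.exp_conj]
  rw [mul_mul_mul_comm, hs, ← Complex.exp_add, ← Complex.exp_nat_mul, ← Complex.exp_nat_mul,
    ← Complex.exp_neg, ← Complex.exp_add, ← Complex.exp_nat_mul]
  congr 2
  simp only [map_div₀, map_mul, map_natCast, Complex.conj_I, Complex.conj_ofReal, map_ofNat]
  field_simp

theorem fourierVec_mul_conj_self {d : ℕ} (hd : 0 < d) (j k : Fin d) :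
    fourierVec d j k * (starRingEnd ℂ) (fourierVec d j k) = (d : ℂ)⁻¹ := by
  rw [fourierVec_mul_conj hd, mul_inv_cancel₀ (pow_ne_zero _ (Complex.exp_ne_zero _)), one_pow,
    mul_one]

theorem sum_fourierVec_mul_conj {d : ℕ} (hd : 0 < d) (k l : Fin d) :
    ∑ j, fourierVec d j k * (starRingEnd ℂ) (fourierVec d j l) = if k = l then 1 else 0 := by
  have hd' : (d : ℂ) ≠ 0 := by exact_mod_cast hd.ne'
  split_ifs with h
  · subst h
    simp [fourierVec_mul_conj_self hd, hd']
  · have hζ := Complex.isPrimitiveRoot_exp d hd.ne'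
    simp only [fourierVec_mul_conj hd]
    generalize Complex.exp (2 * Real.pi * Complex.I / (d : ℂ)) = z at hζ ⊢
    have hz : z ≠ 0 := hζ.ne_zero hd.ne'
    have h1 : z ^ (k : ℕ) * (z ^ (l : ℕ))⁻¹ ≠ 1 := by
      intro h1
      rw [mul_inv_eq_one₀ (pow_ne_zero _ hz)] at h1
      exact h (Fin.ext (hζ.pow_inj k.2 l.2 h1))
    rw [← Finset.mul_sum, Fin.sum_univ_eq_sum_range
      (fun j => (z ^ (k : ℕ) * (z ^ (l : ℕ))⁻¹) ^ j) d, geom_sum_eq h1, mul_pow, inv_pow,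
      ← pow_mul, ← pow_mul, mul_comm (k : ℕ), mul_comm (l : ℕ), pow_mul, pow_mul, hζ.pow_eq_one]
    simp

theorem fourierPOVM_castAdd (d m : ℕ) (j : Fin d) :
    fourierPOVM d (d + m) (Fin.castAdd m j) =
      Matrix.vecMulVec (fourierVec d j) (star (fourierVec d j)) := by
  ext k l
  simp [fourierPOVM, Matrix.vecMulVec_apply]

theorem fourierPOVM_natAdd (d m : ℕ) (j : Fin m) :
    fourierPOVM d (d + m) (Fin.natAdd d j) = 0 := by
  simp [fourierPOVM]

theorem isPOVM_fourierPOVM {d : ℕ} (hd : 0 < d) (m : ℕ) : IsPOVM (fourierPOVM d (d + m)) := by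
  refine ⟨fun i => ?_, ?_⟩
  · refine Fin.addCases (fun j => ?_) (fun j => ?_) i
    · rw [fourierPOVM_castAdd]
      exact Matrix.posSemidef_vecMulVec_self_star _
    · rw [fourierPOVM_natAdd]
      exact Matrix.PosSemidef.zero
  · simp only [Fin.sum_univ_add, fourierPOVM_castAdd, fourierPOVM_natAdd,
      Finset.sum_const_zero, add_zero]
    ext k l
    rw [Matrix.sum_apply, Matrix.one_apply, ← sum_fourierVec_mul_conj hd]
    simp [Matrix.vecMulVec_apply]

/-- An effect of a POVM is bounded by the identity. -/
theorem IsPOVM.posSemidef_one_sub {d n : ℕ} {M : Fin n → Matrix (Fin d) (Fin d) ℂ}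
    (hM : IsPOVM M) (i : Fin n) : (1 - M i).PosSemidef := by
  rw [← hM.2, ← Finset.add_sum_erase _ _ (Finset.mem_univ i), add_sub_cancel_left]
  exact Matrix.posSemidef_sum _ fun j _ => hM.1 j

/-- The effects `d⁻¹ • 1` (`d` times) and `0` (`m` times). -/
noncomputable def uniformPOVM (d m : ℕ) : Fin (d + m) → Matrix (Fin d) (Fin d) ℂ :=
  Fin.addCases (fun _ => (d : ℝ)⁻¹ • 1) (fun _ => 0)

theorem uniformPOVM_mem_IC {d : ℕ} (hd : 0 < d) (m : ℕ) : uniformPOVM d m ∈ IC d (d + m) := by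
  have hd' : (d : ℝ) ≠ 0 := by exact_mod_cast hd.ne'
  refine ⟨⟨fun i => ?_, ?_⟩, fun a k l hkl => ?_⟩
  · refine Fin.addCases (fun j => ?_) (fun j => ?_) i
    · simpa [uniformPOVM] using Matrix.PosSemidef.one.smul (inv_nonneg.2 (Nat.cast_nonneg' (α := ℝ) d))
    · simpa [uniformPOVM] using Matrix.PosSemidef.zero
  · simp only [uniformPOVM, Fin.sum_univ_add, Fin.addCases_left, Fin.addCases_right,
      Finset.sum_const_zero, add_zero, Finset.sum_const, Finset.card_univ, Fintype.card_fin]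
    rw [← Nat.cast_smul_eq_nsmul ℝ, smul_smul, mul_inv_cancel₀ hd', one_smul]
  · refine Fin.addCases (fun j => ?_) (fun j => ?_) a <;> simp [uniformPOVM, hkl]

theorem sub_one_mem_robustnessSet {d : ℕ} (hd : 0 < d) (m : ℕ) :
    (d : ℝ) - 1 ∈ robustnessSet (IC d (d + m)) (fourierPOVM d (d + m)) := by
  have hM := isPOVM_fourierPOVM hd m
  have h1d : (1 : ℝ) ≤ d := by exact_mod_cast hd
  refine ⟨sub_nonneg.2 h1d, ?_⟩
  obtain rfl | hd1 := (Nat.succ_le_of_lt hd).eq_or_lt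
  · refine ⟨_, hM, ?_⟩
    have hIC : fourierPOVM 1 (1 + m) ∈ IC 1 (1 + m) :=
      ⟨hM, fun a k l hkl => (hkl (Subsingleton.elim k l)).elim⟩
    convert hIC using 2 with i
    simp
  · have hd1' : (1 : ℝ) < d := by exact_mod_cast hd1
    have hs : (d : ℝ) - 1 ≠ 0 := (sub_pos.2 hd1').ne'
    have hd' : (d : ℝ) ≠ 0 := by positivity
    have hU := uniformPOVM_mem_IC hd m
    refine ⟨fun i => ((d : ℝ) - 1)⁻¹ • ((d : ℝ) • uniformPOVM d m i - fourierPOVM d (d + m) i),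
      ⟨fun i => ?_, ?_⟩, ?_⟩
    · refine Matrix.PosSemidef.smul ?_ (inv_nonneg.2 (sub_nonneg.2 h1d))
      refine Fin.addCases (fun j => ?_) (fun j => ?_) i
      · simpa [uniformPOVM, smul_smul, hd'] using hM.posSemidef_one_sub (Fin.castAdd m j)
      · simpa [uniformPOVM, fourierPOVM_natAdd] using Matrix.PosSemidef.zero
    · rw [← Finset.smul_sum, Finset.sum_sub_distrib, ← Finset.smul_sum, hU.1.2, hM.2]
      nth_rewrite 2 [← one_smul ℝ (1 : Matrix (Fin d) (Fin d) ℂ)]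
      rw [← sub_smul, smul_smul, inv_mul_cancel₀ hs, one_smul]
    · convert hU using 2 with i
      rw [smul_smul, mul_inv_cancel₀ hs, one_smul, add_sub_cancel, add_sub_cancel, smul_smul,
        inv_mul_cancel₀ hd', one_smul]

open Matrix in
/-- On diagonal matrices the quadratic form at a Fourier basis vector is the normalized trace. -/
theorem fourierVec_dotProduct_mulVec {d : ℕ} (hd : 0 < d) (j : Fin d)
    {S : Matrix (Fin d) (Fin d) ℂ} (hS : ∀ k l, k ≠ l → S k l = 0) :
    star (fourierVec d j) ⬝ᵥ S *ᵥ fourierVec d j = (d : ℂ)⁻¹ * S.trace := by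
  have h : S = Matrix.diagonal S.diag := by
    ext k l
    by_cases hkl : k = l
    · simp [hkl]
    · simp [hkl, hS k l hkl]
  rw [h, Matrix.trace_diagonal, Finset.mul_sum, dotProduct]
  refine Finset.sum_congr rfl fun k _ => ?_
  rw [Matrix.mulVec_diagonal, ← fourierVec_mul_conj_self hd j k, Pi.star_apply, starRingEnd_apply]
  ring

open Matrix in
theorem fourierVec_dotProduct_vecMulVec {d : ℕ} (hd : 0 < d) (j : Fin d) :
    star (fourierVec d j) ⬝ᵥ
      Matrix.vecMulVec (fourierVec d j) (star (fourierVec d j)) *ᵥ fourierVec d j = 1 := by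
  have hd' : (d : ℂ) ≠ 0 := by exact_mod_cast hd.ne'
  have h : star (fourierVec d j) ⬝ᵥ fourierVec d j = 1 := by
    simpa [hd'] using fourierVec_dotProduct_mulVec hd j (S := 1) fun k l => Matrix.one_apply_ne
  rw [Matrix.vecMulVec_mulVec, h]
  simp [h]

theorem sub_one_le_of_mem_robustnessSet {d : ℕ} (hd : 0 < d) (m : ℕ) {s : ℝ}
    (hs : s ∈ robustnessSet (IC d (d + m)) (fourierPOVM d (d + m))) : (d : ℝ) - 1 ≤ s := by
  obtain ⟨hs0, N, hN, hS⟩ := hs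
  have hd' : (d : ℝ) ≠ 0 := by exact_mod_cast hd.ne'
  set S := fun i => (1 + s)⁻¹ • (fourierPOVM d (d + m) i + s • N i) with hSdef
  have key (j : Fin d) : (1 + s)⁻¹ ≤ (d : ℝ)⁻¹ * (S (Fin.castAdd m j)).trace.re := by
    have h := fourierVec_dotProduct_mulVec hd j (hS.2 (Fin.castAdd m j))
    have hNj := (Complex.le_def.1
      ((hN.1 (Fin.castAdd m j)).dotProduct_mulVec_nonneg (fourierVec d j))).1
    have h' := congrArg Complex.re h
    have hSj : S (Fin.castAdd m j) = (1 + s)⁻¹ • (Matrix.vecMulVec (fourierVec d j)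
        (star (fourierVec d j)) + s • N (Fin.castAdd m j)) := by
      rw [hSdef, ← fourierPOVM_castAdd]
    rw [← Complex.ofReal_natCast, ← Complex.ofReal_inv, Complex.re_ofReal_mul] at h'
    rw [← h', hSj]
    simp only [Matrix.smul_mulVec, Matrix.add_mulVec, dotProduct_add, dotProduct_smul,
      fourierVec_dotProduct_vecMulVec hd, Complex.smul_re, Complex.add_re, Complex.one_re,
      smul_eq_mul]
    refine le_mul_of_one_le_right (by positivity) (le_add_of_nonneg_right (mul_nonneg hs0 hNj))
  have htr : ∑ i, (S i).trace.re = d := by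
    rw [← Complex.re_sum, ← Matrix.trace_sum, hS.1.2]
    simp
  rw [Fin.sum_univ_add] at htr
  have hrest : 0 ≤ ∑ i : Fin m, (S (Fin.natAdd d i)).trace.re :=
    Finset.sum_nonneg fun i _ => (Complex.le_def.1 (hS.1.1 _).trace_nonneg).1
  have hsum := Finset.sum_le_sum fun j (_ : j ∈ Finset.univ) => key j
  rw [← Finset.mul_sum, Finset.sum_const, Finset.card_univ, Fintype.card_fin, nsmul_eq_mul]
    at hsum
  have hle : (d : ℝ) * (1 + s)⁻¹ ≤ 1 := hsum.trans <| by
    rw [inv_mul_le_iff₀ (by positivity)]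
    linarith
  rw [mul_inv_le_iff₀ (by positivity)] at hle
  linarith

/-- The Fourier POVM achieves the maximal robustness `d − 1` with respect to
incoherent measurements. -/
theorem robustness_IC_fourier {d n : ℕ} (hd : 0 < d) (hdn : d ≤ n) :
    robustness (IC d n) (fourierPOVM d n) = (d : ℝ) - 1 := by
  obtain ⟨m, rfl⟩ := Nat.exists_eq_add_of_le hdn
  exact IsLeast.csInf_eq
    ⟨sub_one_mem_robustnessSet hd m, fun _ => sub_one_le_of_mem_robustnessSet hd m⟩
end

section
/- Let n ≥ d ≥ 1 and M ∈ P(d,n). Then R_IC(M) = d − 1 if and only if every effect of M is proportional to a maximally coherent pure state, i.e. for every a ∈ {1,…,n} there exist α_a ≥ 0 and a unit vector ψ_a ∈ ℂ^d with |⟨j|ψ_a⟩|² = 1/d for all standard basis indices j, such that M_a = α_a |ψ_a⟩⟨ψ_a|. -/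
open scoped BigOperators ComplexOrder

open Matrix in
/-- A family of real diagonal matrices dominating the effects of `M`, with sum dominated by
`μ > 1`, shows that `μ - 1` is an admissible noise parameter. -/
lemma sub_one_mem_robustnessSet_IC {d n : ℕ} (hn : 0 < n) {M : Fin n → Matrix (Fin d) (Fin d) ℂ}
    (hM : IsPOVM M) {t : Fin n → Fin d → ℝ} {μ : ℝ} (hμ : 1 < μ)
    (ht : ∀ a, (diagonal (fun j => (t a j : ℂ)) - M a).PosSemidef)
    (hs : ∀ j, ∑ a, t a j ≤ μ) : μ - 1 ∈ robustnessSet (IC d n) M := by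
  let r : Fin n → Fin d → ℝ := fun a j => if a = ⟨0, hn⟩ then μ - ∑ b, t b j else 0
  have hr : ∀ a j, 0 ≤ r a j := fun a j => by
    by_cases h : a = ⟨0, hn⟩
    · simp [r, h, hs j]
    · simp [r, h]
  have hsum : ∑ a, diagonal (fun j => ((t a j + r a j : ℝ) : ℂ)) =
      (μ : ℂ) • (1 : Matrix (Fin d) (Fin d) ℂ) := by
    ext i j
    rw [Matrix.sum_apply]
    by_cases h : i = j
    · subst h
      simp only [diagonal_apply_eq, Matrix.smul_apply, one_apply_eq, ← Complex.ofReal_sum,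
        Finset.sum_add_distrib]
      simp [r]
    · simp [h]
  have hdom : ∀ a, (diagonal (fun j => ((t a j + r a j : ℝ) : ℂ)) - M a).PosSemidef := fun a => by
    have h : (diagonal (fun j => (r a j : ℂ))).PosSemidef :=
      PosSemidef.diagonal fun j => by simpa using hr a j
    convert (ht a).add h using 1
    ext i j
    by_cases h : i = j
    · subst h; simp; ring
    · simp [h]
  have hdiag : ∀ a, (diagonal (fun j => ((t a j + r a j : ℝ) : ℂ))).PosSemidef := fun a => by
    simpa using (hdom a).add (hM.1 a)
  have hμ0 : μ ≠ 0 := by positivity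
  have hμ1 : μ - 1 ≠ 0 := by linarith
  have hmix : (fun a => (1 + (μ - 1))⁻¹ • (M a + (μ - 1) • ((μ - 1)⁻¹ •
      (diagonal (fun j => ((t a j + r a j : ℝ) : ℂ)) - M a)))) =
      fun a => μ⁻¹ • diagonal (fun j => ((t a j + r a j : ℝ) : ℂ)) := by
    funext a
    rw [smul_inv_smul₀ hμ1]
    simp
  refine ⟨by linarith, fun a => (μ - 1)⁻¹ •
    (diagonal (fun j => ((t a j + r a j : ℝ) : ℂ)) - M a), ⟨fun a => ?_, ?_⟩, ?_⟩
  · exact (hdom a).smul (inv_nonneg.2 (by linarith))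
  · rw [← Finset.smul_sum, Finset.sum_sub_distrib, hsum, hM.2]
    have : (μ : ℂ) • (1 : Matrix (Fin d) (Fin d) ℂ) - 1 = (μ - 1) • 1 := by
      ext i j
      simp [sub_mul]
    rw [this, inv_smul_smul₀ hμ1]
  · rw [hmix]
    refine ⟨⟨fun a => (hdiag a).smul (inv_nonneg.2 (by linarith)), ?_⟩, fun a i j h => by simp [h]⟩
    rw [← Finset.smul_sum, hsum]
    ext i j
    simp [hμ0]

lemma bddBelow_robustnessSet {d n : ℕ} (F : Set (Fin n → Matrix (Fin d) (Fin d) ℂ))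
    (M : Fin n → Matrix (Fin d) (Fin d) ℂ) : BddBelow (robustnessSet F M) :=
  ⟨0, fun _ h => h.1⟩

open Matrix in
lemma robustness_IC_le {d n : ℕ} (hd : 0 < d) (hn : 0 < n)
    {M : Fin n → Matrix (Fin d) (Fin d) ℂ}
    (hM : IsPOVM M) {t : Fin n → Fin d → ℝ} {μ : ℝ}
    (ht : ∀ a, (diagonal (fun j => (t a j : ℂ)) - M a).PosSemidef)
    (hs : ∀ j, ∑ a, t a j ≤ μ) : robustness (IC d n) M ≤ μ - 1 := by
  have hμ : 1 ≤ μ := by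
    refine le_trans ?_ (hs ⟨0, hd⟩)
    have h1 : ∑ a, (M a ⟨0, hd⟩ ⟨0, hd⟩).re = 1 := by
      rw [← Complex.re_sum, ← Matrix.sum_apply, hM.2]
      simp
    rw [← h1]
    refine Finset.sum_le_sum fun a _ => ?_
    have := (Complex.le_def.1 ((ht a).diag_nonneg (i := ⟨0, hd⟩))).1
    simpa using this
  refine le_of_forall_pos_le_add fun ε hε => ?_
  have := csInf_le (bddBelow_robustnessSet (IC d n) M)
    (sub_one_mem_robustnessSet_IC hn hM (μ := μ + ε) (by linarith) ht
      fun j => (hs j).trans (by linarith))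
  unfold robustness
  linarith

open Matrix in
/-- The largest eigenvalue `α` of a positive semidefinite matrix is at most the trace, with
equality only for multiples of rank-one projections. -/
lemma Matrix.PosSemidef.exists_max_eigenvalue {d : ℕ} (hd : 0 < d)
    {A : Matrix (Fin d) (Fin d) ℂ} (hA : A.PosSemidef) :
    ∃ (α : ℝ) (ψ : Fin d → ℂ), 0 ≤ α ∧ ∑ j, Complex.normSq (ψ j) = 1 ∧
      (diagonal (fun _ => (α : ℂ)) - A).PosSemidef ∧ α ≤ A.trace.re ∧
      (A.trace.re ≤ α → A = α • Matrix.of (fun k l => ψ k * (starRingEnd ℂ) (ψ l))) := by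
  have : Nonempty (Fin d) := ⟨⟨0, hd⟩⟩
  obtain ⟨m, hm⟩ := Finite.exists_max hA.1.eigenvalues
  have hnn := hA.eigenvalues_nonneg
  set ev := hA.1.eigenvalues with hev
  set U : Matrix (Fin d) (Fin d) ℂ := hA.1.eigenvectorUnitary.1
  have hUU : U * Uᴴ = 1 := Unitary.mul_star_self_of_mem hA.1.eigenvectorUnitary.2
  have hUU' : Uᴴ * U = 1 := Unitary.star_mul_self_of_mem hA.1.eigenvectorUnitary.2
  have hspec : A = U * diagonal (fun k => (ev k : ℂ)) * Uᴴ := by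
    have h := hA.1.spectral_theorem
    rw [Unitary.conjStarAlgAut_apply] at h
    exact h
  have htr : A.trace.re = ∑ k, ev k := by
    rw [hA.1.trace_eq_sum_eigenvalues]
    simp [hev]
  refine ⟨ev m, fun j => U j m, hnn m, ?_, ?_, ?_, fun h => ?_⟩
  · have h := congrFun (congrFun hUU' m) m
    rw [mul_apply, one_apply_eq] at h
    simp only [conjTranspose_apply, RCLike.star_def, ← Complex.normSq_eq_conj_mul_self] at h
    exact_mod_cast h
  · have h : diagonal (fun _ => (ev m : ℂ)) - A =
        U * diagonal (fun k => ((ev m - ev k : ℝ) : ℂ)) * Uᴴ := by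
      have h1 : diagonal (fun k => ((ev m - ev k : ℝ) : ℂ)) =
          (ev m : ℂ) • (1 : Matrix (Fin d) (Fin d) ℂ) - diagonal (fun k => (ev k : ℂ)) := by
        ext i j
        by_cases h : i = j
        · subst h; simp
        · simp [h]
      rw [h1, mul_sub, sub_mul, ← hspec, mul_smul_comm, mul_one, smul_mul_assoc, hUU,
        smul_one_eq_diagonal]
    rw [h]
    refine PosSemidef.mul_mul_conjTranspose_same (PosSemidef.diagonal fun k => ?_) U
    simpa using hm k
  · rw [htr]
    exact Finset.single_le_sum (fun k _ => hnn k) (Finset.mem_univ m)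
  · have h0 : ∀ k, k ≠ m → ev k = 0 := fun k hk => by
      have h1 : ∑ k ∈ Finset.univ.erase m, ev k ≤ 0 := by
        have := Finset.add_sum_erase Finset.univ ev (Finset.mem_univ m)
        linarith
      exact le_antisymm ((Finset.single_le_sum (fun k _ => hnn k)
        (Finset.mem_erase.2 ⟨hk, Finset.mem_univ k⟩)).trans h1) (hnn k)
    ext i j
    conv_lhs => rw [hspec]
    rw [mul_apply, Finset.sum_eq_single m]
    · simp; ring
    · intro k _ hk
      simp [h0 k hk]
    · simp

lemma star_dotProduct_diagonal_sub_mulVec {d : ℕ} (t : Fin d → ℝ) (α : ℝ) (ψ x : Fin d → ℂ) :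
    star x ⬝ᵥ ((Matrix.diagonal (fun j => (t j : ℂ)) -
      α • Matrix.of (fun k l => ψ k * (starRingEnd ℂ) (ψ l))).mulVec x) =
      ((∑ j, t j * Complex.normSq (x j) -
        α * Complex.normSq (∑ j, (starRingEnd ℂ) (x j) * ψ j) : ℝ) : ℂ) := by
  rw [Matrix.sub_mulVec, dotProduct_sub, Matrix.smul_mulVec, dotProduct_smul]
  push_cast
  congr 1
  · simp only [dotProduct, Matrix.mulVec_diagonal, Pi.star_apply, RCLike.star_def,
      Complex.normSq_eq_conj_mul_self]
    exact Finset.sum_congr rfl fun j _ => by ring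
  · rw [← Complex.mul_conj, map_sum, Finset.sum_mul_sum]
    simp only [dotProduct, Matrix.mulVec, Matrix.of_apply, Pi.star_apply, RCLike.star_def,
      Complex.real_smul, Finset.mul_sum, map_mul, Complex.conj_conj]
    exact Finset.sum_congr rfl fun i _ => Finset.sum_congr rfl fun j _ => by ring

/-- Weighted pinching inequality for rank-one matrices. -/
lemma posSemidef_diagonal_div_sub_rankOne {d : ℕ} {α : ℝ} (hα : 0 ≤ α) (ψ : Fin d → ℂ)
    {w : Fin d → ℝ} (hw : ∀ j, 0 < w j) (hw1 : ∑ j, w j = 1) :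
    (Matrix.diagonal (fun j => ((α * Complex.normSq (ψ j) / w j : ℝ) : ℂ)) -
      α • Matrix.of (fun k l => ψ k * (starRingEnd ℂ) (ψ l))).PosSemidef := by
  refine Matrix.PosSemidef.of_dotProduct_mulVec_nonneg ?_ fun x => ?_
  · ext i j
    by_cases h : i = j
    · subst h; simp [mul_comm]
    · simp [h, Ne.symm h, mul_comm]
  · rw [star_dotProduct_diagonal_sub_mulVec, Complex.zero_le_real, sub_nonneg]
    have h1 : Complex.normSq (∑ j, (starRingEnd ℂ) (x j) * ψ j) ≤
        ∑ j, (‖x j‖ * ‖ψ j‖) ^ 2 / w j := by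
      have h2 := Finset.sq_sum_div_le_sum_sq_div Finset.univ (fun j => ‖x j‖ * ‖ψ j‖)
        fun j _ => hw j
      rw [hw1, div_one] at h2
      refine le_trans ?_ h2
      rw [Complex.normSq_eq_norm_sq]
      gcongr
      refine (norm_sum_le _ _).trans_eq (Finset.sum_congr rfl fun j _ => ?_)
      simp
    refine (mul_le_mul_of_nonneg_left h1 hα).trans_eq ?_
    rw [Finset.mul_sum]
    refine Finset.sum_congr rfl fun j _ => ?_
    rw [Complex.normSq_eq_norm_sq, Complex.normSq_eq_norm_sq]
    ring

/-- If some distribution `p a` of positive weight is not uniform, suitable pinching weights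
beat the uniform ones. -/
lemma exists_pinching_weights {d n : ℕ} (hd : 0 < d) {α : Fin n → ℝ} {p : Fin n → Fin d → ℝ}
    (hα : ∀ a, 0 ≤ α a) (hp : ∀ a j, 0 ≤ p a j) (hp1 : ∀ a, ∑ j, p a j = 1)
    (hα1 : ∀ j, ∑ a, α a * p a j = 1) {b : Fin n} {k : Fin d} (hb : 0 < α b)
    (hbk : p b k ≠ 1 / d) :
    ∃ (w : Fin n → Fin d → ℝ) (μ : ℝ), (∀ a j, 0 < w a j) ∧ (∀ a, ∑ j, w a j = 1) ∧ μ < d ∧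
      ∀ j, ∑ a, α a * p a j / w a j ≤ μ := by
  have hd' : (0 : ℝ) < d := Nat.cast_pos.2 hd
  have hα2 : ∑ a, α a = d := by
    calc ∑ a, α a = ∑ a, ∑ j, α a * p a j := by simp [← Finset.mul_sum, hp1]
      _ = d := by rw [Finset.sum_comm]; simp [hα1]
  let v : Fin n → Fin d → ℝ := fun a j => (1 / d + p a j) / 2
  have hv : ∀ a j, 1 / (2 * d) ≤ v a j := fun a j => by
    have := hp a j
    have h : (1 : ℝ) / (2 * d) = 1 / d / 2 := by field_simp
    simp only [v, h]
    linarith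
  have hv0 : ∀ a j, 0 < v a j := fun a j => lt_of_lt_of_le (by positivity) (hv a j)
  have hv1 : ∀ a, ∑ j, v a j = 1 := fun a => by
    simp only [v, ← Finset.sum_div, Finset.sum_add_distrib, hp1]
    simp
    field_simp
    norm_num
  have hgap : ∀ a j, (d * p a j + 1) / 2 - p a j / v a j =
      (d * p a j - 1) ^ 2 / (2 * (d * p a j + 1)) := fun a j => by
    have h1 : (0 : ℝ) < 1 + d * p a j := by have := hp a j; positivity
    have h2 : v a j = (1 + d * p a j) / (2 * d) := by simp only [v]; field_simp
    rw [h2]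
    have h3 : (d * p a j + 1 : ℝ) ≠ 0 := by linarith
    field_simp
    ring
  have hle : ∀ a j, p a j / v a j ≤ (d * p a j + 1) / 2 := fun a j => by
    have h : 0 ≤ (d * p a j - 1) ^ 2 / (2 * (d * p a j + 1)) := by
      have := hp a j; positivity
    linarith [hgap a j]
  have hlt : p b k / v b k < (d * p b k + 1) / 2 := by
    have h : 0 < (d * p b k - 1) ^ 2 / (2 * (d * p b k + 1)) := by
      have h1 : d * p b k - 1 ≠ 0 := fun h => hbk (by field_simp; linarith)
      have := hp b k; positivity
    linarith [hgap b k]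
  have htot : ∀ j, ∑ a, α a * ((d * p a j + 1) / 2) = d := fun j => by
    have h : ∀ a, α a * ((d * p a j + 1) / 2) = d / 2 * (α a * p a j) + α a / 2 := fun a => by
      ring
    simp only [h, Finset.sum_add_distrib, ← Finset.mul_sum, ← Finset.sum_div, hα1, hα2]
    ring
  let T : Fin d → ℝ := fun j => ∑ a, α a * (p a j / v a j)
  have hT0 : ∀ j, 0 ≤ T j := fun j =>
    Finset.sum_nonneg fun a _ => mul_nonneg (hα a) (div_nonneg (hp a j) (hv0 a j).le)
  have hT : ∀ j, T j ≤ d := fun j => by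
    rw [← htot j]
    exact Finset.sum_le_sum fun a _ => mul_le_mul_of_nonneg_left (hle a j) (hα a)
  have hTk : T k < d := by
    rw [← htot k]
    exact Finset.sum_lt_sum (fun a _ => mul_le_mul_of_nonneg_left (hle a k) (hα a))
      ⟨b, Finset.mem_univ b, mul_lt_mul_of_pos_left hlt hb⟩
  obtain ⟨ε, hε⟩ : ∃ ε, ε = (d - T k) / (d + 1) := ⟨_, rfl⟩
  have hε0 : 0 < ε := hε ▸ div_pos (by linarith) (by linarith)
  have hε1 : ε < 1 := by rw [hε, div_lt_one (by linarith)]; linarith [hT0 k]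
  have hεT : T k = d - ε * (d + 1) := by rw [hε]; field_simp; ring
  let r : Fin d → ℝ := fun j => if j = k then 1 - ε else 1
  have hr0 : ∀ j, 0 < r j := fun j => by
    by_cases h : j = k
    · simp [r, h, hε1]
    · simp [r, h]
  let Z : Fin n → ℝ := fun a => 1 - ε * v a k
  have hZ : ∀ a, ∑ j, v a j * r j = Z a := fun a => by
    have h : ∀ j, v a j * r j = v a j - if j = k then ε * v a j else 0 := fun j => by
      by_cases h : j = k
      · simp [r, h]; ring
      · simp [r, h]
    simp only [h, Finset.sum_sub_distrib, hv1]
    simp [Z]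
  have hZ0 : ∀ a, 0 < Z a := fun a => by
    rw [← hZ a]
    exact Finset.sum_pos (fun j _ => mul_pos (hv0 a j) (hr0 j)) ⟨k, Finset.mem_univ k⟩
  have hZle : ∀ a, Z a ≤ 1 - ε / (2 * d) := fun a => by
    have := mul_le_mul_of_nonneg_left (hv a k) hε0.le
    have h : ε / (2 * d) = ε * (1 / (2 * d)) := by ring
    simp only [Z, h]
    linarith
  refine ⟨fun a j => v a j * r j / Z a, d - ε / 2,
    fun a j => div_pos (mul_pos (hv0 a j) (hr0 j)) (hZ0 a), fun a => ?_, by linarith, fun j => ?_⟩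
  · rw [← Finset.sum_div, hZ, div_self (hZ0 a).ne']
  · have h1 : ∑ a, α a * p a j / (v a j * r j / Z a) ≤ (1 - ε / (2 * d)) / r j * T j := by
      simp only [T, Finset.mul_sum]
      refine Finset.sum_le_sum fun a _ => ?_
      have h2 : α a * p a j / (v a j * r j / Z a) = Z a / r j * (α a * (p a j / v a j)) := by
        have := (hv0 a j).ne'
        have := (hr0 j).ne'
        have := (hZ0 a).ne'
        field_simp
      rw [h2]
      have := hr0 j
      refine mul_le_mul_of_nonneg_right (by gcongr; exact hZle a)
        (mul_nonneg (hα a) (div_nonneg (hp a j) (hv0 a j).le))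
    refine h1.trans ?_
    have h3 : (1 - ε / (2 * d)) * d = d - ε / 2 := by field_simp
    have h4 : ε / (2 * d) < 1 := by
      have h5 : (1 : ℝ) ≤ d := by exact_mod_cast hd
      rw [div_lt_one (by linarith)]
      linarith
    by_cases h : j = k
    · subst h
      have h5 : 0 < ε / (2 * d) := by positivity
      simp only [r, if_true]
      rw [div_mul_eq_mul_div, div_le_iff₀ (by linarith)]
      calc (1 - ε / (2 * d)) * T j ≤ 1 * T j :=
            mul_le_mul_of_nonneg_right (by linarith) (hT0 j)
        _ ≤ (d - ε / 2) * (1 - ε) := by rw [hεT]; nlinarith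
    · simp only [r, h, if_false, div_one]
      rw [← h3]
      exact mul_le_mul_of_nonneg_left (hT j) (by linarith)

open Matrix in
/-- Every admissible noise parameter is at least `d - 1` if all effects are proportional to
maximally coherent pure states. -/
lemma sub_one_le_of_mem_robustnessSet_IC {d n : ℕ} (hd : 0 < d)
    {M : Fin n → Matrix (Fin d) (Fin d) ℂ} (hM : IsPOVM M) {α : Fin n → ℝ}
    {ψ : Fin n → Fin d → ℂ} (hψ : ∀ a j, Complex.normSq (ψ a j) = 1 / d)
    (h : ∀ a, M a = α a • Matrix.of (fun k l => ψ a k * (starRingEnd ℂ) (ψ a l))) {s : ℝ}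
    (hs : s ∈ robustnessSet (IC d n) M) : (d : ℝ) - 1 ≤ s := by
  obtain ⟨hs0, N, hN, ⟨hS, hoff⟩⟩ := hs
  have hd' : (0 : ℝ) < d := Nat.cast_pos.2 hd
  have h1s : (1 + s) ≠ 0 := by positivity
  set S : Fin n → Matrix (Fin d) (Fin d) ℂ := fun i => (1 + s)⁻¹ • (M i + s • N i) with hSdef
  have hdiff : ∀ a, ((1 + s) • S a - M a).PosSemidef := fun a => by
    have : (1 + s) • S a - M a = s • N a := by
      simp only [hSdef]
      rw [smul_inv_smul₀ h1s]
      simp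
    rw [this]
    exact (hN.1 a).smul hs0
  have hSd : ∀ a, (1 + s) • S a = diagonal (fun j => (((1 + s) * (S a j j).re : ℝ) : ℂ)) :=
    fun a => by
    ext i j
    by_cases hij : i = j
    · subst hij
      have him : (S a i i).im = 0 := ((Complex.le_def.1 (hS.1 a).diag_nonneg).2).symm
      apply Complex.ext <;> simp [him]
    · simp [hij, hoff a i j hij]
  have hsumψ : ∀ a, ∑ j, (starRingEnd ℂ) (ψ a j) * ψ a j = 1 := fun a => by
    simp only [← Complex.normSq_eq_conj_mul_self, hψ]
    simp
    field_simp
  have hαle : ∀ a, α a ≤ (1 + s) / d * ∑ j, (S a j j).re := fun a => by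
    have h1 := (hdiff a).dotProduct_mulVec_nonneg (ψ a)
    rw [hSd, h a, star_dotProduct_diagonal_sub_mulVec, Complex.zero_le_real, hsumψ] at h1
    simp only [hψ, ← Finset.mul_sum, ← Finset.sum_mul, map_one, mul_one] at h1
    have : (1 + s) / d * ∑ j, (S a j j).re = ((1 + s) * ∑ j, (S a j j).re) * (1 / d) := by ring
    linarith
  have hSsum : ∑ a, ∑ j, (S a j j).re = d := by
    rw [Finset.sum_comm]
    simp [← Complex.re_sum, ← Matrix.sum_apply, hS.2]
  have hαsum : ∑ a, α a = d := by
    have h1 : ∀ a, α a * (1 / d) = (M a ⟨0, hd⟩ ⟨0, hd⟩).re := fun a => by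
      rw [h a, ← hψ a ⟨0, hd⟩]
      simp [Complex.normSq_apply]
    have h2 : ∑ a, α a * (1 / d) = 1 := by
      simp only [h1, ← Complex.re_sum, ← Matrix.sum_apply, hM.2]
      simp
    rw [← Finset.sum_mul] at h2
    field_simp at h2
    linarith
  have hfin := Finset.sum_le_sum fun a (_ : a ∈ Finset.univ) => hαle a
  rw [← Finset.mul_sum, hSsum, hαsum, div_mul_cancel₀ _ hd'.ne'] at hfin
  linarith

/-- A POVM on `ℂ^d` with `n ≥ d` outcomes attains the maximal robustness `d − 1` with
respect to incoherent measurements if and only if all of its effects are proportional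
to rank-one projectors onto maximally coherent pure states. -/
theorem robustness_IC_max_iff {d n : ℕ} (hd : 0 < d) (hdn : d ≤ n)
    (M : Fin n → Matrix (Fin d) (Fin d) ℂ) (hM : IsPOVM M) :
    robustness (IC d n) M = (d : ℝ) - 1 ↔
      ∀ a, ∃ (α : ℝ) (ψ : Fin d → ℂ),
        0 ≤ α ∧
        (∑ j, Complex.normSq (ψ j)) = 1 ∧
        (∀ j, Complex.normSq (ψ j) = 1 / d) ∧
        M a = α • Matrix.of (fun k l => ψ k * (starRingEnd ℂ) (ψ l)) := by
  have hn : 0 < n := hd.trans_le hdn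
  have hd' : (0 : ℝ) < d := Nat.cast_pos.2 hd
  choose α ψ hα hψ hdom htr heq using fun a => (hM.1 a).exists_max_eigenvalue hd
  have htrace : ∑ a, (M a).trace.re = d := by
    rw [← Complex.re_sum, ← Matrix.trace_sum, hM.2]
    simp
  have hαsum : ∑ a, α a ≤ d := htrace ▸ Finset.sum_le_sum fun a _ => htr a
  constructor
  · intro hR a
    have hαd : (d : ℝ) ≤ ∑ a, α a := by
      have := robustness_IC_le hd hn hM (t := fun a _ => α a) hdom fun _ => le_rfl
      linarith
    have hall : ∀ a, α a = (M a).trace.re := by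
      have := (Finset.sum_eq_sum_iff_of_le fun a (_ : a ∈ Finset.univ) => htr a).1
        (by linarith)
      exact fun a => this a (Finset.mem_univ a)
    have hrank := fun a => heq a (hall a).ge
    by_cases ha : α a = 0
    · refine ⟨0, fun _ => ((Real.sqrt (1 / d) : ℝ) : ℂ), le_rfl, ?_, fun j => ?_, ?_⟩
      · simp [Complex.normSq_ofReal, hd'.ne']
      · rw [Complex.normSq_ofReal, Real.mul_self_sqrt (by positivity)]
      · rw [hrank a, ha, zero_smul, zero_smul]
    · refine ⟨α a, ψ a, hα a, hψ a, fun j => ?_, hrank a⟩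
      by_contra hj
      have hdiag : ∀ j, ∑ a, α a * Complex.normSq (ψ a j) = 1 := fun j => by
        have h : ∀ a, α a * Complex.normSq (ψ a j) = (M a j j).re := fun a => by
          rw [hrank a]
          simp [Complex.normSq_apply]
        simp [h, ← Complex.re_sum, ← Matrix.sum_apply, hM.2]
      obtain ⟨w, μ, hw, hw1, hμ, hle⟩ := exists_pinching_weights hd hα
        (fun a j => Complex.normSq_nonneg (ψ a j)) hψ hdiag
        (lt_of_le_of_ne (hα a) (Ne.symm ha)) hj
      have := robustness_IC_le hd hn hM (fun a => by
        rw [hrank a]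
        exact posSemidef_diagonal_div_sub_rankOne (hα a) (ψ a) (hw a) (hw1 a)) hle
      linarith
  · intro h
    refine le_antisymm (robustness_IC_le hd hn hM (t := fun a _ => α a) hdom fun _ => hαsum) ?_
    choose β φ _ _ hφ hMφ using h
    exact le_csInf ⟨_, sub_one_mem_robustnessSet_IC hn hM (t := fun a _ => α a) (μ := d + 1)
      (by linarith) hdom fun _ => hαsum.trans (by linarith)⟩
      fun s hs => sub_one_le_of_mem_robustnessSet_IC hd hM hφ hMφ hs
end
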